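/- arXiv:2301.02752 — 4 statements merged into one kernel-verified Lean document; each statement's English description precedes it below -/
import Mathlib

section
/- An abelian group G of bounded period is a strong retract if and only if in its decomposition into a direct sum of primary cyclic groups the orders of any two distinct direct summands are either equal or coprime; that is, if and only if G is isomorphic to a direct sum ⊕_{i=1}^m C_{p_i^{k_i}}(n_i), where p_1,…,p_m are distinct primes, k_i ∈ ℕ, n_i are cardinal numbers, and C_{p^k}(n) denotes the direct sum of n copies of ℤ/p^kℤ. -/
universe u

/-- `K` belongs to the variety generated by `H`: every identity (word in a free group)
that holds identically in `H` also holds identically in `K`. -/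
def InVarietyOf (H : Type u) [Group H] (K : Type u) [Group K] : Prop :=
  ∀ (n : ℕ) (w : FreeGroup (Fin n)),
    (∀ f : Fin n → H, FreeGroup.lift f w = 1) →
    ∀ f : Fin n → K, FreeGroup.lift f w = 1

/-- `H` is a strong retract: for every group `G` in the variety generated by `H`
containing `H` (via an injective homomorphism `ι`), there is a retraction of `G`
onto (the copy of) `H`. -/
def IsStrongRetract (H : Type u) [Group H] : Prop :=
  ∀ (G : Type u) [Group G], ∀ ι : H →* G, Function.Injective ι →
    InVarietyOf H G → ∃ ρ : G →* H, ∀ h : H, ρ (ι h) = h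


section Variety

variable {G K : Type u} [Group K]

theorem FreeGroup.exists_lift_eq_prod_zpow {n : ℕ} (w : FreeGroup (Fin n)) :
    ∃ a : Fin n → ℤ, ∀ (H : Type u) [CommGroup H] (f : Fin n → H),
      FreeGroup.lift f w = ∏ i, f i ^ a i := by
  induction w using FreeGroup.induction_on with
  | C1 => exact ⟨0, by simp⟩
  | of i =>
    refine ⟨Pi.single i 1, fun H _ f => ?_⟩
    rw [Finset.prod_eq_single i] <;> simp +contextual
  | inv_of i ih =>
    obtain ⟨a, ha⟩ := ih
    exact ⟨-a, fun H _ f => by simp [ha H f]⟩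
  | mul x y hx hy =>
    obtain ⟨a, ha⟩ := hx
    obtain ⟨b, hb⟩ := hy
    exact ⟨a + b, fun H _ f => by simp [ha H f, hb H f, zpow_add, Finset.prod_mul_distrib]⟩

theorem inVarietyOf_of_pow_exponent_eq_one {K : Type u} [CommGroup G] [CommGroup K]
    (h : ∀ x : K, x ^ Monoid.exponent G = 1) : InVarietyOf G K := by
  intro n w hw f
  obtain ⟨a, ha⟩ := FreeGroup.exists_lift_eq_prod_zpow.{u} w
  rw [ha]
  refine Finset.prod_eq_one fun i _ => ?_
  have hdvd : (Monoid.exponent G : ℤ) ∣ a i := by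
    refine Int.natCast_dvd.mpr (Monoid.exponent_dvd_of_forall_pow_eq_one fun g => ?_)
    have hg := hw (Pi.mulSingle i g)
    rw [ha, Finset.prod_eq_single i (fun j _ hj => by simp [hj]) (by simp),
      Pi.mulSingle_eq_same] at hg
    rcases Int.natAbs_eq (a i) with hi | hi
    · rwa [hi, zpow_natCast] at hg
    · rwa [hi, zpow_neg, zpow_natCast, inv_eq_one] at hg
  obtain ⟨b, hb⟩ := hdvd
  rw [hb, zpow_mul, zpow_natCast, h, one_zpow]

theorem InVarietyOf.mul_comm [CommGroup G] (h : InVarietyOf G K) (x y : K) : x * y = y * x := by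
  have hw := h 2 (FreeGroup.of 0 * FreeGroup.of 1 * (FreeGroup.of 0)⁻¹ * (FreeGroup.of 1)⁻¹)
    (fun f => by simp) ![x, y]
  simpa [mul_inv_eq_one, mul_inv_eq_iff_eq_mul] using hw

theorem InVarietyOf.pow_eq_one [Group G] (h : InVarietyOf G K) {n : ℕ}
    (hn : ∀ g : G, g ^ n = 1) (x : K) : x ^ n = 1 := by
  simpa using h 1 (FreeGroup.of 0 ^ n) (fun f => by simp [hn]) ![x]

end Variety

/-- Whenever `n = d * e`, every element of `A` killed by `e` is divisible by `d`. If `n` kills `A`,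
this says that `A` is an injective `ℤ/n`-module. -/
def TorsionDivisible (n : ℕ) (A : Type*) [AddCommGroup A] : Prop :=
  ∀ d e : ℕ, d * e = n → ∀ g : A, e • g = 0 → ∃ x, d • x = g

namespace TorsionDivisible

theorem of_addEquiv {n : ℕ} {A B : Type*} [AddCommGroup A] [AddCommGroup B] (f : A ≃+ B)
    (h : TorsionDivisible n A) : TorsionDivisible n B := by
  intro d e hde g hg
  obtain ⟨x, hx⟩ := h d e hde (f.symm g) (by rw [← map_nsmul, hg, map_zero])
  exact ⟨f x, by rw [← map_nsmul, hx, f.apply_symm_apply]⟩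

theorem exists_section {n : ℕ} {A : Type*} [AddCommGroup A] (h : TorsionDivisible n A)
    {d e : ℕ} (hde : d * e = n) :
    ∃ s : A → A, s 0 = 0 ∧ ∀ g, e • g = 0 → d • s g = g := by
  have key : ∀ g : A, ∃ x, (g = 0 → x = 0) ∧ (e • g = 0 → d • x = g) := by
    intro g
    by_cases hg0 : g = 0
    · exact ⟨0, by simp [hg0]⟩
    by_cases hg : e • g = 0
    · obtain ⟨x, hx⟩ := h d e hde g hg
      exact ⟨x, by simp [hg0, hx]⟩
    · exact ⟨0, by simp [hg]⟩
  choose s hs using key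
  exact ⟨s, (hs 0).1 rfl, fun g => (hs g).2⟩

theorem finsupp {n : ℕ} {A I : Type*} [AddCommGroup A] (h : TorsionDivisible n A) :
    TorsionDivisible n (I →₀ A) := by
  intro d e hde g hg
  obtain ⟨s, hs0, hs⟩ := h.exists_section hde
  refine ⟨g.mapRange s hs0, Finsupp.ext fun i => ?_⟩
  simpa using hs (g i) (by simpa using DFunLike.congr_fun hg i)

theorem directSum {n : ℕ} {ι : Type*} {A : ι → Type*} [∀ i, AddCommGroup (A i)]
    (h : ∀ i, TorsionDivisible n (A i)) : TorsionDivisible n (DirectSum ι A) := by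
  intro d e hde g hg
  choose s hs0 hs using fun i => (h i).exists_section hde
  refine ⟨DFinsupp.mapRange s hs0 g, DFinsupp.ext fun i => ?_⟩
  have hi : e • g i = 0 := by
    rw [← DirectSum.smul_apply, hg, DirectSum.zero_apply]
  rw [DirectSum.smul_apply]
  simpa using hs i (g i) hi

theorem zmod {n q r : ℕ} (hn : q * r = n) (hqr : q.Coprime r) (hn0 : n ≠ 0) :
    TorsionDivisible n (ZMod q) := by
  intro d e hde g hg
  have hq : q ≠ 0 := by rintro rfl; simp_all
  have : NeZero q := ⟨hq⟩
  have h1 : q ∣ e * g.val := by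
    rw [← ZMod.natCast_eq_zero_iff]
    simpa using hg
  have h2 : d ∣ r * g.val := by
    have : q * d ∣ q * (r * g.val) := by
      obtain ⟨t, ht⟩ := h1
      exact ⟨t, by
        calc q * (r * g.val) = d * e * g.val := by rw [hde, ← hn]; ring
          _ = d * (e * g.val) := by ring
          _ = q * d * t := by rw [ht]; ring⟩
    exact Nat.dvd_of_mul_dvd_mul_left (Nat.pos_of_ne_zero hq) this
  have h3 : d.gcd q ∣ g.val :=
    (hqr.coprime_dvd_left (Nat.gcd_dvd_right d q)).dvd_of_dvd_mul_left
      ((Nat.gcd_dvd_left d q).trans h2)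
  obtain ⟨t, ht⟩ := h3
  refine ⟨(d.gcdA q : ZMod q) * t, ?_⟩
  have hb := congrArg (Int.cast : ℤ → ZMod q) (Nat.gcd_eq_gcd_ab d q)
  push_cast [ZMod.natCast_self] at hb
  rw [nsmul_eq_mul, ← mul_assoc, ← ZMod.natCast_zmod_val g, ht]
  push_cast
  rw [hb]
  ring

theorem baer {n : ℕ} [NeZero n] {A : Type*} [AddCommGroup A] [Module (ZMod n) A]
    (h : TorsionDivisible n A) : Module.Baer (ZMod n) A := by
  intro I g
  have hpir : IsPrincipalIdealRing (ZMod n) :=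
    IsPrincipalIdealRing.of_surjective (Int.castRingHom (ZMod n)) ZMod.intCast_surjective
  obtain ⟨a, ha⟩ := (hpir.principal I).principal
  have haI : a ∈ I := ha ▸ Submodule.mem_span_singleton_self a
  obtain ⟨e, he⟩ := Nat.gcd_dvd_right a.val n
  have hea : e • (⟨a, haI⟩ : I) = 0 := by
    ext
    obtain ⟨t, ht⟩ := Nat.gcd_dvd_left a.val n
    have : n ∣ e * a.val := ⟨t, by
      calc e * a.val = a.val.gcd n * e * t := by nth_rw 1 [ht]; ring
        _ = n * t := by rw [← he]⟩
    rw [← ZMod.natCast_eq_zero_iff] at this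
    simpa using this
  obtain ⟨x, hx⟩ := h _ e he.symm (g ⟨a, haI⟩) (by rw [← map_nsmul, hea, map_zero])
  have hb := congrArg (Int.cast : ℤ → ZMod n) (Nat.gcd_eq_gcd_ab a.val n)
  push_cast [ZMod.natCast_self, ZMod.natCast_zmod_val] at hb
  have hax : a • (a.val.gcdA n : ZMod n) • x = g ⟨a, haI⟩ := by
    rw [← hx, ← Nat.cast_smul_eq_nsmul (ZMod n), hb, smul_smul, zero_mul, add_zero]
  refine ⟨LinearMap.toSpanSingleton (ZMod n) A ((a.val.gcdA n : ZMod n) • x), fun y hy => ?_⟩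
  obtain ⟨c, rfl⟩ := Submodule.mem_span_singleton.mp (ha ▸ hy)
  have : (⟨c • a, hy⟩ : I) = c • ⟨a, haI⟩ := rfl
  rw [this, map_smul, map_smul, LinearMap.toSpanSingleton_apply, hax]

theorem isStrongRetract {n : ℕ} (hn : n ≠ 0) {G : Type u} [CommGroup G]
    (hG : ∀ g : G, g ^ n = 1) (h : TorsionDivisible n (Additive G)) : IsStrongRetract G := by
  intro K _ ι hι hK
  let _ : CommGroup K := { ‹Group K› with mul_comm := hK.mul_comm }
  have : NeZero n := ⟨hn⟩
  let _ : Module (ZMod n) (Additive G) := AddCommGroup.zmodModule hG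
  let _ : Module (ZMod n) (Additive K) := AddCommGroup.zmodModule (hK.pow_eq_one hG)
  obtain ⟨ρ, hρ⟩ := h.baer.injective.out (ι.toAdditive.toZModLinearMap n) hι LinearMap.id
  exact ⟨ρ.toAddMonoidHom.toMultiplicative, hρ⟩

theorem of_isStrongRetract {G : Type u} [CommGroup G] (hn : Monoid.exponent G ≠ 0)
    (h : IsStrongRetract G) : TorsionDivisible (Monoid.exponent G) (Additive G) := by
  intro d e hde g hg
  set n := Monoid.exponent G
  let g' : G := g.toMul
  let c : Multiplicative (ZMod n) := Multiplicative.ofAdd 1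
  have hg' : g' ^ e = 1 := hg
  have hc (m : ℤ) (hm : c ^ m = 1) : (n : ℤ) ∣ m := by
    rw [← ZMod.intCast_zmod_eq_zero_iff_dvd]
    simpa [c, ← ofAdd_zsmul] using hm
  let N : Subgroup (G × Multiplicative (ZMod n)) := Subgroup.zpowers (g', (c ^ d)⁻¹)
  let ι : G →* (G × Multiplicative (ZMod n)) ⧸ N := (QuotientGroup.mk' N).comp (MonoidHom.inl _ _)
  have hι : Function.Injective ι := by
    rw [injective_iff_map_eq_one]
    intro x hx
    have hx' : ((x, 1) : G × Multiplicative (ZMod n)) ∈ N := (QuotientGroup.eq_one_iff _).mp hx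
    obtain ⟨m, hm⟩ := Subgroup.mem_zpowers_iff.mp hx'
    rw [Prod.pow_mk, Prod.mk.injEq, inv_zpow, inv_eq_one, ← zpow_natCast, ← zpow_mul] at hm
    obtain ⟨t, ht⟩ := hc _ hm.2
    have hd : (d : ℤ) ≠ 0 := Nat.cast_ne_zero.mpr (left_ne_zero_of_mul (hde ▸ hn))
    have hm' : m = e * t := by
      apply mul_left_cancel₀ hd
      rw [ht, ← hde]
      push_cast
      ring
    rw [← hm.1, hm', zpow_mul, zpow_natCast, hg', one_zpow]
  obtain ⟨ρ, hρ⟩ := h _ ι hι (inVarietyOf_of_pow_exponent_eq_one fun x => by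
    induction x using QuotientGroup.induction_on with
    | H x =>
      rw [← QuotientGroup.mk_pow]
      have : x ^ n = 1 := Prod.ext (Monoid.pow_exponent_eq_one x.1) <|
        Multiplicative.toAdd.injective (by simp)
      rw [this, QuotientGroup.mk_one])
  refine ⟨Additive.ofMul (ρ (QuotientGroup.mk' N (1, c))), ?_⟩
  have : QuotientGroup.mk' N (g', 1) = QuotientGroup.mk' N (1, c) ^ d := by
    rw [← map_pow]
    refine (QuotientGroup.eq.mpr ?_).symm
    convert Subgroup.mem_zpowers (g', (c ^ d)⁻¹) using 1
    simp
  have h2 := hρ g'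
  change ρ (QuotientGroup.mk' N (g', 1)) = g' at h2
  rw [this, map_pow] at h2
  exact h2

/-- The integral lift of a basis of `A/pA` presents `A` as a free `ℤ/p^k`-module. -/
theorem exists_addEquiv_finsupp_zmod {p k : ℕ} (hp : p.Prime) {A : Type u}
    [AddCommGroup A] (hA : ∀ a : A, p ^ k • a = 0) (h : TorsionDivisible (p ^ k) A) :
    ∃ I : Type u, Nonempty (A ≃+ (I →₀ ZMod (p ^ k))) := by
  have : Fact p.Prime := ⟨hp⟩
  let b := Module.Free.chooseBasis (ZMod p) (ModN A p)
  let π : A →+ ModN A p := ModN.mkQ p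
  have hπ : Function.Surjective π := Submodule.mkQ_surjective _
  have hπ0 (a : A) (ha : π a = 0) : ∃ a', a = p • a' := by
    obtain ⟨a', ha'⟩ := (Submodule.Quotient.mk_eq_zero _).mp ha
    exact ⟨a', by simpa using ha'.symm⟩
  have hπp (a : A) : π (p • a) = 0 :=
    (Submodule.Quotient.mk_eq_zero _).mpr ⟨a, by simp⟩
  choose v hv using fun i => hπ (b i)
  let T := (Finsupp.linearCombination ℤ v).toAddMonoidHom
  have hT (c) (i) : b.repr (π (T c)) i = (c i : ZMod p) := by
    have : π (T c) = c.sum fun j z => (z : ZMod p) • b j := by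
      simp [T, Finsupp.linearCombination_apply, Finsupp.sum, hv, Int.cast_smul_eq_zsmul]
    rw [this]
    simp +contextual [Finsupp.sum, Finsupp.single_apply]
  let red (q : ℕ) : (_ →₀ ℤ) →+ (_ →₀ ZMod q) :=
    Finsupp.mapRange.addMonoidHom (ι := Module.Free.ChooseBasisIndex (ZMod p) (ModN A p))
      (Int.castAddHom (ZMod q))
  have hred (q : ℕ) : Function.Surjective (red q) :=
    Finsupp.mapRange_surjective _ (map_zero _) ZMod.intCast_surjective
  have hred0 (q : ℕ) (c) : red q c = 0 ↔ ∃ c', c = q • c' := by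
    constructor
    · intro hc
      have hdvd (i) : (q : ℤ) ∣ c i :=
        (ZMod.intCast_zmod_eq_zero_iff_dvd _ _).mp (DFunLike.congr_fun hc i)
      refine ⟨c.mapRange (· / (q : ℤ)) (Int.zero_ediv _), Finsupp.ext fun i => ?_⟩
      simp [Int.mul_ediv_cancel' (hdvd i)]
    · rintro ⟨c', rfl⟩
      ext i
      simp [red]
  have hTred (c) : b.repr (π (T c)) = red p c := Finsupp.ext fun i => by rw [hT]; rfl
  have hsurj (a : A) (j : ℕ) : ∃ c a', a = T c + p ^ j • a' := by
    induction j with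
    | zero => exact ⟨0, a, by simp⟩
    | succ j ih =>
      obtain ⟨c, a', rfl⟩ := ih
      obtain ⟨c', hc'⟩ := hred p (b.repr (π a'))
      obtain ⟨a'', ha''⟩ := hπ0 (a' - T c') (by
        rw [map_sub, sub_eq_zero]
        apply b.repr.injective
        rw [hTred, hc'])
      refine ⟨c + p ^ j • c', a'', ?_⟩
      rw [sub_eq_iff_eq_add.mp ha'']
      simp only [map_add, map_nsmul, smul_add, pow_succ, mul_smul]
      abel
  have hTsurj : Function.Surjective T := fun a => by
    obtain ⟨c, a', h'⟩ := hsurj a k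
    exact ⟨c, by rw [h', hA, add_zero]⟩
  have hker : T.ker = (red (p ^ k)).ker := by
    ext c
    rw [AddMonoidHom.mem_ker, AddMonoidHom.mem_ker, hred0]
    constructor
    · intro hc
      have hind : ∀ j ≤ k, ∃ c', c = p ^ j • c' := by
        intro j hj
        induction j with
        | zero => exact ⟨c, by simp⟩
        | succ j ih =>
          obtain ⟨c', hc'⟩ := ih (by omega)
          obtain ⟨y, hy⟩ := h (p ^ (k - j)) (p ^ j) (by rw [← pow_add]; congr 1; omega) (T c')
            (by rw [← map_nsmul, ← hc', hc])
          have : red p c' = 0 := by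
            rw [← hTred, ← hy, show k - j = (k - j - 1) + 1 by omega, pow_succ', mul_smul, hπp,
              map_zero]
          obtain ⟨c'', rfl⟩ := (hred0 p c').mp this
          exact ⟨c'', by rw [hc', pow_succ, mul_smul]⟩
      exact hind k le_rfl
    · rintro ⟨c', rfl⟩
      rw [map_nsmul, hA]
  exact ⟨_, ⟨(QuotientAddGroup.quotientKerEquivOfSurjective T hTsurj).symm.trans
    ((QuotientAddGroup.quotientAddEquivOfEq hker).trans
      (QuotientAddGroup.quotientKerEquivOfSurjective _ (hred (p ^ k))))⟩⟩

theorem exists_addEquiv_directSum {n : ℕ} (hn : n ≠ 0) {A : Type u} [AddCommGroup A]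
    (hA : ∀ a : A, n • a = 0) (h : TorsionDivisible n A) :
    ∃ (m : ℕ) (p k : Fin m → ℕ) (I : Fin m → Type u),
      (∀ i, (p i).Prime) ∧ Function.Injective p ∧ (∀ i, 1 ≤ k i) ∧
      Nonempty (A ≃+ DirectSum (Fin m) fun i => (I i →₀ ZMod (p i ^ k i))) := by
  classical
  let S := n.primeFactors
  let q : ℕ → ℤ := fun p => ((p ^ n.factorization p : ℕ) : ℤ)
  have hint : DirectSum.IsInternal fun i : S => Submodule.torsionBy ℤ A (q i) := by
    refine Submodule.torsionBy_isInternal ?_ ?_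
    · intro p hp r hr hpr
      refine Nat.isCoprime_iff_coprime.mpr ?_
      exact Nat.coprime_pow_primes _ _ (Nat.prime_of_mem_primeFactors hp)
        (Nat.prime_of_mem_primeFactors hr) hpr
    · intro a
      have hprod : ∏ i ∈ S, q i = (n : ℤ) := by
        rw [← Nat.cast_prod]
        exact congrArg _ (Nat.prod_factorization_pow_eq_self hn)
      change (∏ i ∈ S, q i) • a = 0
      rw [hprod, natCast_zsmul, hA]
  have hmem (i : ℕ) (x : A) : x ∈ Submodule.torsionBy ℤ A (q i) ↔
      i ^ n.factorization i • x = 0 := by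
    rw [Submodule.mem_torsionBy_iff, natCast_zsmul]
  have hcomp (i : S) : ∃ I : Type u, Nonempty (Submodule.torsionBy ℤ A (q i) ≃+
      (I →₀ ZMod ((i : ℕ) ^ n.factorization i))) := by
    refine exists_addEquiv_finsupp_zmod (Nat.prime_of_mem_primeFactors i.2)
      (fun a => Subtype.ext ((hmem _ _).mp a.2)) ?_
    intro d e hde x hx
    obtain ⟨r, hr⟩ : (i : ℕ) ^ n.factorization i ∣ n := Nat.ordProj_dvd n i
    obtain ⟨y, hy⟩ := h (d * r) e (by rw [hr, ← hde]; ring) x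
      (by simpa using congrArg Subtype.val hx)
    refine ⟨⟨r • y, (hmem _ _).mpr ?_⟩, Subtype.ext ?_⟩
    · rw [← mul_smul, ← hr, hA]
    · simpa [mul_smul] using hy
  choose I hI using hcomp
  let ε := S.equivFin
  refine ⟨S.card, fun j => (ε.symm j : ℕ), fun j => n.factorization (ε.symm j),
    fun j => I (ε.symm j), fun j => Nat.prime_of_mem_primeFactors (ε.symm j).2,
    Subtype.val_injective.comp ε.symm.injective, fun j => ?_, ⟨?_⟩⟩
  · have hj := (ε.symm j).2
    exact (Nat.prime_of_mem_primeFactors hj).factorization_pos_of_dvd hn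
      (Nat.dvd_of_mem_primeFactors hj)
  · exact (AddEquiv.ofBijective _ hint).symm.trans
      ((DFinsupp.mapRange.addEquiv fun i => (hI i).some).trans (DirectSum.equivCongrLeft ε))

end TorsionDivisible

/-- Proposition 2: an abelian group of bounded period is a strong retract if and only if
it decomposes as a direct sum ⊕_{i=1}^m C_{p_i^{k_i}}(n_i) where the pᵢ are distinct
primes, kᵢ ≥ 1, and each C_{p^k}(n) is a direct sum of n copies of ℤ/pᵏℤ (so the orders
of any two distinct primary cyclic summands are either equal or coprime). -/
theorem abelian_bounded_strong_retract_iff (G : Type u) [CommGroup G]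
    (hb : ∃ n : ℕ, 1 ≤ n ∧ ∀ g : G, g ^ n = 1) :
    IsStrongRetract G ↔
      ∃ (m : ℕ) (p k : Fin m → ℕ) (I : Fin m → Type u),
        (∀ i, (p i).Prime) ∧ Function.Injective p ∧ (∀ i, 1 ≤ k i) ∧
        Nonempty (G ≃* Multiplicative (DirectSum (Fin m) fun i => (I i →₀ ZMod (p i ^ k i)))) := by
  constructor
  · intro h
    have hn : Monoid.exponent G ≠ 0 := by
      obtain ⟨n, hn, hG⟩ := hb
      exact Monoid.exponent_ne_zero.mpr ⟨n, hn, hG⟩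
    obtain ⟨m, p, k, I, hp, hinj, hk, ⟨f⟩⟩ :=
      (TorsionDivisible.of_isStrongRetract hn h).exists_addEquiv_directSum hn
        (fun g => Monoid.pow_exponent_eq_one g.toMul)
    exact ⟨m, p, k, I, hp, hinj, hk, ⟨AddEquiv.toMultiplicativeRight f⟩⟩
  · rintro ⟨m, p, k, I, hp, hinj, -, ⟨f⟩⟩
    have hn : ∏ i, p i ^ k i ≠ 0 :=
      Finset.prod_ne_zero_iff.mpr fun i _ => pow_ne_zero _ (hp i).ne_zero
    refine TorsionDivisible.isStrongRetract hn (fun g => f.injective ?_)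
      (TorsionDivisible.of_addEquiv (MulEquiv.toAdditiveLeft f).symm
        (TorsionDivisible.directSum fun i => TorsionDivisible.finsupp
          (TorsionDivisible.zmod (Finset.mul_prod_erase _ _ (Finset.mem_univ i)) ?_ hn)))
    · rw [map_pow, map_one]
      refine DFinsupp.ext fun i => Finsupp.ext fun j => ?_
      change (∏ i, p i ^ k i) • ((f g).toAdd i j) = 0
      rw [nsmul_eq_mul, (ZMod.natCast_eq_zero_iff _ _).mpr
        (Finset.dvd_prod_of_mem _ (Finset.mem_univ i)), zero_mul]
    · exact Nat.Coprime.prod_right fun j hj => Nat.coprime_pow_primes _ _ (hp i) (hp j)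
        fun hij => Finset.ne_of_mem_erase hj (hinj hij.symm)
end

section
/- Every nilpotent strong retract is an abelian group. -/
universe u

/-- The variety generated by `H` contains the quotients of `H × H`. -/
theorem InVarietyOf.of_surjective_prod {H K : Type u} [Group H] [Group K] (π : H × H →* K)
    (hπ : Function.Surjective π) : InVarietyOf H K := by
  intro n w hw f
  choose s hs using fun i => hπ (f i)
  have hlift : FreeGroup.lift s w = 1 := by
    have h₁ := FreeGroup.lift_unique (f := fun i => (s i).1)
      ((MonoidHom.fst H H).comp (FreeGroup.lift s)) (by simp) (x := w)
    have h₂ := FreeGroup.lift_unique (f := fun i => (s i).2)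
      ((MonoidHom.snd H H).comp (FreeGroup.lift s)) (by simp) (x := w)
    rw [hw] at h₁ h₂
    exact Prod.ext h₁ h₂
  have hf := FreeGroup.lift_unique (f := f) (π.comp (FreeGroup.lift s)) (by simp [hs]) (x := w)
  rw [← hf, MonoidHom.comp_apply, hlift, map_one]

/-- The subgroup `{(z, z⁻¹) | z ∈ center H}` of `H × H`; the quotient by it is the central product
of two copies of `H` amalgamated along the center. -/
def centerAntidiagonal (H : Type u) [Group H] : Subgroup (H × H) where
  carrier := {p | p.1 ∈ Subgroup.center H ∧ p.1 * p.2 = 1}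
  one_mem' := by simp
  mul_mem' := by
    rintro ⟨a, b⟩ ⟨c, d⟩ ⟨ha, hab : a * b = 1⟩ ⟨hc, hcd : c * d = 1⟩
    refine ⟨Subgroup.mul_mem _ ha hc, ?_⟩
    obtain rfl := eq_inv_of_mul_eq_one_right hab
    obtain rfl := eq_inv_of_mul_eq_one_right hcd
    have := Subgroup.mem_center_iff.mp ha c
    simp [← this]
  inv_mem' := by
    rintro ⟨a, b⟩ ⟨ha, hab : a * b = 1⟩
    refine ⟨Subgroup.inv_mem _ ha, ?_⟩
    obtain rfl := eq_inv_of_mul_eq_one_right hab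
    simp

instance centerAntidiagonal_normal (H : Type u) [Group H] : (centerAntidiagonal H).Normal where
  conj_mem := by
    rintro ⟨a, b⟩ ⟨ha, hab : a * b = 1⟩ ⟨g, h⟩
    refine ⟨Subgroup.Normal.conj_mem inferInstance a ha g, ?_⟩
    obtain rfl := eq_inv_of_mul_eq_one_right hab
    have hg := Subgroup.mem_center_iff.mp ha g
    have hh := Subgroup.mem_center_iff.mp (Subgroup.inv_mem _ ha) h
    simp only [Prod.mk_mul_mk, Prod.inv_mk] at hg hh ⊢
    rw [hg, hh]
    group

/-- A strong retract admits an endomorphism retracting it onto its center. -/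
theorem IsStrongRetract.exists_retraction_center {H : Type u} [Group H] (hH : IsStrongRetract H) :
    ∃ φ : H →* H, (∀ h, φ h ∈ Subgroup.center H) ∧ ∀ z ∈ Subgroup.center H, φ z = z := by
  let π := QuotientGroup.mk' (centerAntidiagonal H)
  have hinj : Function.Injective (π.comp (MonoidHom.inl H H)) := by
    rw [injective_iff_map_eq_one]
    intro h hh
    have hmem : ((h, 1) : H × H) ∈ centerAntidiagonal H := (QuotientGroup.eq_one_iff _).mp hh
    simpa using hmem.2
  obtain ⟨ρ, hρ⟩ := hH _ (π.comp (MonoidHom.inl H H)) hinj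
    (.of_surjective_prod π (QuotientGroup.mk'_surjective _))
  refine ⟨(ρ.comp π).comp (MonoidHom.inr H H), fun h => ?_, fun z hz => ?_⟩
  · rw [Subgroup.mem_center_iff]
    intro g
    have hcomm := ((MonoidHom.commute_inl_inr g h).map (ρ.comp π)).eq
    have hg : (ρ.comp π) (MonoidHom.inl H H g) = g := hρ g
    rwa [hg] at hcomm
  · have hmem : ((z, z⁻¹) : H × H) ∈ centerAntidiagonal H := ⟨hz, mul_inv_cancel z⟩
    have hone : (ρ.comp π) (z, z⁻¹) = 1 := by
      rw [MonoidHom.comp_apply, show π (z, z⁻¹) = 1 from (QuotientGroup.eq_one_iff _).mpr hmem,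
        map_one]
    have hz' : (ρ.comp π) (MonoidHom.inl H H z) = z := hρ z
    have hsplit : ((z, z⁻¹) : H × H) = MonoidHom.inl H H z * (MonoidHom.inr H H z)⁻¹ := by simp
    rw [hsplit, map_mul, map_inv, hz', mul_inv_eq_one] at hone
    exact hone.symm

/-- A retraction of a nilpotent group onto its center is injective. -/
theorem injective_of_retraction_center {H : Type u} [Group H] [Group.IsNilpotent H] (φ : H →* H)
    (hφ : ∀ h, φ h ∈ Subgroup.center H) (hφ' : ∀ z ∈ Subgroup.center H, φ z = z) :
    Function.Injective φ := by
  rw [← MonoidHom.ker_eq_bot_iff]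
  by_contra hker
  have : Nontrivial φ.ker := (Subgroup.nontrivial_iff_ne_bot _).mpr hker
  apply Group.IsNilpotent.center_ne_bot (G := φ.ker)
  rw [Subgroup.eq_bot_iff_forall]
  rintro ⟨n, hn⟩ hnc
  have hcenter : n ∈ Subgroup.center H := by
    rw [Subgroup.mem_center_iff]
    intro g
    have hk : (φ g)⁻¹ * g ∈ φ.ker := by
      rw [MonoidHom.mem_ker, map_mul, map_inv, hφ' _ (hφ g), inv_mul_cancel]
    have h₁ : Commute ((φ g)⁻¹ * g) n :=
      congrArg Subtype.val (Subgroup.mem_center_iff.mp hnc ⟨_, hk⟩)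
    have h₂ : Commute (φ g) n := (Subgroup.mem_center_iff.mp (hφ g) n).symm
    simpa using (h₂.mul_left h₁).eq
  exact Subtype.ext ((hφ' n hcenter).symm.trans hn)

/-- Proposition 4: every nilpotent strong retract is an abelian group. -/
theorem nilpotent_strong_retract_is_abelian (G : Type u) [Group G]
    [Group.IsNilpotent G] (hG : IsStrongRetract G) :
    ∀ a b : G, a * b = b * a := by
  intro a b
  obtain ⟨φ, hφ, hφ'⟩ := hG.exists_retraction_center
  apply injective_of_retraction_center φ hφ hφ'
  rw [map_mul, map_mul]
  exact Subgroup.mem_center_iff.mp (hφ b) (φ a)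
end

section
/- Let H be a subgroup of a group G such that G is finitely presented over H. Then H is algebraically closed in G if and only if H is a retract of G. -/
universe u

/-- A group `G` is finitely presented over its subgroup `H`: there is a finite subset
`A ⊆ G` such that `H ∪ A` generates `G` (i.e. the natural homomorphism
`H ∗ F(A) → G` from the free product of `H` with the free group on `A` is surjective)
and its kernel is the normal closure of a finite subset. -/
def FinitelyPresentedOver {G : Type*} [Group G] (H : Subgroup G) : Prop :=
  ∃ A : Finset G,
    Function.Surjective
      (Monoid.Coprod.lift H.subtype
        (FreeGroup.lift (Subtype.val : ↥(A : Set G) → G))) ∧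
    ∃ S : Finset (Monoid.Coprod H (FreeGroup ↥(A : Set G))),
      Subgroup.normalClosure (S : Set _) =
        (Monoid.Coprod.lift H.subtype
          (FreeGroup.lift (Subtype.val : ↥(A : Set G) → G))).ker

/-- A subgroup `H` of `G` is algebraically closed in `G`: every finite system of
equations `wᵢ(x₁,…,xₙ) = 1` with `wᵢ ∈ H ∗ F(x₁,…,xₙ)` (the free product of `H` with
a free group) that has a solution in `G` has a solution in `H`. -/
def Subgroup.IsAlgebraicallyClosedIn {G : Type*} [Group G] (H : Subgroup G) : Prop :=
  ∀ (n m : ℕ) (w : Fin m → Monoid.Coprod H (FreeGroup (Fin n))),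
    (∃ f : Fin n → G, ∀ i,
        Monoid.Coprod.lift H.subtype (FreeGroup.lift f) (w i) = 1) →
    ∃ f : Fin n → H, ∀ i,
        Monoid.Coprod.lift (MonoidHom.id H) (FreeGroup.lift f) (w i) = 1

/-- Evaluation of words with coefficients in `H` commutes with retractions onto `H`. -/
theorem Monoid.Coprod.lift_id_freeGroup_lift_comp {G : Type*} [Group G] {H : Subgroup G}
    {α : Type*} (r : G →* H) (hr : r.comp H.subtype = MonoidHom.id H) (f : α → G) :
    Monoid.Coprod.lift (MonoidHom.id H) (FreeGroup.lift fun a => r (f a)) =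
      r.comp (Monoid.Coprod.lift H.subtype (FreeGroup.lift f)) := by
  refine Monoid.Coprod.hom_ext ?_ (FreeGroup.ext_hom _ _ fun a => ?_)
  · rw [MonoidHom.comp_assoc, Monoid.Coprod.lift_comp_inl, Monoid.Coprod.lift_comp_inl, hr]
  · simp

/-- A retract of a group is algebraically closed in it. -/
theorem Subgroup.IsAlgebraicallyClosedIn.of_retraction {G : Type*} [Group G] {H : Subgroup G}
    (r : G →* H) (hr : r.comp H.subtype = MonoidHom.id H) : H.IsAlgebraicallyClosedIn := by
  rintro n m w ⟨f, hf⟩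
  refine ⟨fun i => r (f i), fun i => ?_⟩
  rw [Monoid.Coprod.lift_id_freeGroup_lift_comp r hr, MonoidHom.comp_apply, hf, map_one]

/-- In an algebraically closed subgroup, finite systems of equations indexed by arbitrary finite
types of variables and equations that are solvable in the group are solvable in the subgroup. -/
theorem Subgroup.IsAlgebraicallyClosedIn.exists_solution {G : Type*} [Group G] {H : Subgroup G}
    (h : H.IsAlgebraicallyClosedIn) {α ι : Type*} [Finite α] [Finite ι]
    (w : ι → Monoid.Coprod H (FreeGroup α)) (f : α → G)
    (hf : ∀ i, Monoid.Coprod.lift H.subtype (FreeGroup.lift f) (w i) = 1) :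
    ∃ f' : α → H, ∀ i,
      Monoid.Coprod.lift (MonoidHom.id H) (FreeGroup.lift f') (w i) = 1 := by
  let e := Finite.equivFin α
  let d := Finite.equivFin ι
  have key {K : Type _} [Group K] (j : H →* K) (g : Fin (Nat.card α) → K) :
      (Monoid.Coprod.lift j (FreeGroup.lift g)).comp
        (Monoid.Coprod.map (MonoidHom.id H) (FreeGroup.map e)) =
      Monoid.Coprod.lift j (FreeGroup.lift (g ∘ e)) := by
    refine Monoid.Coprod.hom_ext ?_ (FreeGroup.ext_hom _ _ fun a => ?_)
    · ext; simp
    · simp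
  obtain ⟨g, hg⟩ := h (Nat.card α) (Nat.card ι)
    (fun i => Monoid.Coprod.map (MonoidHom.id H) (FreeGroup.map e) (w (d.symm i)))
    ⟨f ∘ e.symm, fun i => by
      rw [← MonoidHom.comp_apply, key, Function.comp_assoc, e.symm_comp_self,
        Function.comp_id, hf]⟩
  refine ⟨g ∘ e, fun i => ?_⟩
  rw [← key, MonoidHom.comp_apply]
  simpa using hg (d i)

/-- An algebraically closed subgroup over which the group is finitely presented is a retract. -/
theorem Subgroup.IsAlgebraicallyClosedIn.exists_retraction {G : Type*} [Group G] {H : Subgroup G}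
    (h : H.IsAlgebraicallyClosedIn) (hfp : FinitelyPresentedOver H) :
    ∃ r : G →* H, r.comp H.subtype = MonoidHom.id H := by
  obtain ⟨A, hsurj, S, hS⟩ := hfp
  obtain ⟨f, hf⟩ := h.exists_solution (fun s : S => s.1) (Subtype.val : ↥(A : Set G) → G)
    fun s => MonoidHom.mem_ker.1 (hS ▸ Subgroup.subset_normalClosure s.2)
  have hker : (Monoid.Coprod.lift H.subtype
      (FreeGroup.lift (Subtype.val : ↥(A : Set G) → G))).ker ≤
      (Monoid.Coprod.lift (MonoidHom.id H) (FreeGroup.lift f)).ker :=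
    hS ▸ Subgroup.normalClosure_le_normal fun s hs => hf ⟨s, hs⟩
  refine ⟨MonoidHom.liftOfSurjective _ hsurj ⟨_, hker⟩, MonoidHom.ext fun x => ?_⟩
  have := MonoidHom.liftOfRightInverse_comp_apply _ _ (Function.rightInverse_surjInv hsurj)
    ⟨_, hker⟩ (Monoid.Coprod.inl x)
  rw [Monoid.Coprod.lift_apply_inl, Monoid.Coprod.lift_apply_inl] at this
  exact this

/-- Lemma 3: if `G` is finitely presented over its subgroup `H`, then `H` is
algebraically closed in `G` if and only if `H` is a retract of `G`. -/
theorem algebraicallyClosed_iff_retract (G : Type u) [Group G] (H : Subgroup G)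
    (hfp : FinitelyPresentedOver H) :
    H.IsAlgebraicallyClosedIn ↔
      ∃ ρ : G →* G, (∀ g : G, ρ g ∈ H) ∧ ∀ h ∈ H, ρ h = h := by
  constructor
  · intro h
    obtain ⟨r, hr⟩ := h.exists_retraction hfp
    exact ⟨H.subtype.comp r, fun g => (r g).2,
      fun x hx => congrArg H.subtype (DFunLike.congr_fun hr ⟨x, hx⟩)⟩
  · rintro ⟨ρ, hmem, hid⟩
    exact .of_retraction (ρ.codRestrict H hmem) (MonoidHom.ext fun x => Subtype.ext (hid x x.2))
end

section
/- Let K be a field, n ≥ 1, and H = H_n(K) the Heisenberg group of dimension 2n+1 over K. Then the natural embedding of H into the central product G = (H × H̃)/{(c, c⁻¹) : c ∈ H'} of H with a copy H̃ of itself with joined commutator subgroup (induced by h ↦ (h, 1)) is a verbally closed subgroup of G. -/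
universe u

open Monoid in
/-- A subgroup `H` of `G` is verbally closed: every equation `w(x₁,…,xₙ) = h` with
`w` in a free group and `h ∈ H` that has a solution in `G` has a solution in `H`. -/
def Subgroup.IsVerballyClosed {G : Type*} [Group G] (H : Subgroup G) : Prop :=
  ∀ (n : ℕ) (w : FreeGroup (Fin n)) (h : G), h ∈ H →
    (∃ f : Fin n → G, FreeGroup.lift f w = h) →
    ∃ f : Fin n → G, (∀ i, f i ∈ H) ∧ FreeGroup.lift f w = h

/-- A group `H` is strongly verbally closed: it is algebraically closed in every group
containing it as a verbally closed subgroup. -/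
def IsStronglyVerballyClosed (H : Type u) [Group H] : Prop :=
  ∀ (G : Type u) [Group G], ∀ ι : H →* G, Function.Injective ι →
    ι.range.IsVerballyClosed → ι.range.IsAlgebraicallyClosedIn


open Matrix

/-- The Heisenberg group `H_n(K)` of dimension `2n+1` over a field `K`: upper
unitriangular `(n+2)×(n+2)` matrices `T(ā, b̄, c)` with first row `(1, ā, c)`, middle
block `Iₙ` with last column `b̄`, and last row `(0,…,0,1)`; here recorded by the data
`(ā, b̄, c)` with the induced matrix multiplication. -/
@[ext] structure Heis (K : Type*) [Field K] (n : ℕ) where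
  a : Fin n → K
  b : Fin n → K
  c : K

namespace Heis

variable {K : Type*} [Field K] {n : ℕ}

instance : Mul (Heis K n) :=
  ⟨fun g h => ⟨g.a + h.a, g.b + h.b, g.c + h.c + g.a ⬝ᵥ h.b⟩⟩
instance : One (Heis K n) := ⟨⟨0, 0, 0⟩⟩
instance : Inv (Heis K n) := ⟨fun g => ⟨-g.a, -g.b, -g.c + g.a ⬝ᵥ g.b⟩⟩

@[simp] lemma mul_a (g h : Heis K n) : (g * h).a = g.a + h.a := rfl
@[simp] lemma mul_b (g h : Heis K n) : (g * h).b = g.b + h.b := rfl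
@[simp] lemma mul_c (g h : Heis K n) : (g * h).c = g.c + h.c + g.a ⬝ᵥ h.b := rfl
@[simp] lemma one_a : (1 : Heis K n).a = 0 := rfl
@[simp] lemma one_b : (1 : Heis K n).b = 0 := rfl
@[simp] lemma one_c : (1 : Heis K n).c = 0 := rfl
@[simp] lemma inv_a (g : Heis K n) : (g⁻¹).a = -g.a := rfl
@[simp] lemma inv_b (g : Heis K n) : (g⁻¹).b = -g.b := rfl
@[simp] lemma inv_c (g : Heis K n) : (g⁻¹).c = -g.c + g.a ⬝ᵥ g.b := rfl

instance : Group (Heis K n) where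
  mul_assoc x y z := by
    ext <;> simp [add_dotProduct, dotProduct_add, add_assoc] <;> ring
  one_mul x := by ext <;> simp
  mul_one x := by ext <;> simp
  inv_mul_cancel x := by ext <;> simp [neg_dotProduct]

end Heis

namespace Heis

variable {K : Type*} [Field K] {n : ℕ}

/-- The projection of the Heisenberg group onto its abelian quotient `Kⁿ × Kⁿ`. -/
def toAbelian (K : Type*) [Field K] (n : ℕ) :
    Heis K n →* Multiplicative ((Fin n → K) × (Fin n → K)) where
  toFun x := Multiplicative.ofAdd (x.a, x.b)
  map_one' := rfl
  map_mul' _ _ := rfl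

lemma a_eq_zero_and_b_eq_zero_of_mem_commutator {x : Heis K n}
    (hx : x ∈ commutator (Heis K n)) : x.a = 0 ∧ x.b = 0 := by
  have h := Abelianization.commutator_subset_ker (toAbelian K n) hx
  exact Prod.ext_iff.mp (Multiplicative.ofAdd.injective (MonoidHom.mem_ker.mp h))

/-- The antidiagonal `{(z, z⁻¹)}`, with `z` ranging over the matrices `T(0, 0, c)`. -/
def antidiagonal (K : Type*) [Field K] (n : ℕ) : Subgroup (Heis K n × Heis K n) where
  carrier := {x | (x.1.a = 0 ∧ x.1.b = 0) ∧ (x.2.a = 0 ∧ x.2.b = 0) ∧ x.1.c + x.2.c = 0}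
  one_mem' := by simp
  mul_mem' := by
    rintro x y ⟨⟨h₁, h₂⟩, ⟨h₃, h₄⟩, h₅⟩ ⟨⟨k₁, k₂⟩, ⟨k₃, k₄⟩, k₅⟩
    refine ⟨by simp [*], by simp [*], ?_⟩
    simp only [Prod.fst_mul, Prod.snd_mul, mul_c, h₁, h₃, zero_dotProduct]
    linear_combination h₅ + k₅
  inv_mem' := by
    rintro x ⟨⟨h₁, h₂⟩, ⟨h₃, h₄⟩, h₅⟩
    refine ⟨by simp [*], by simp [*], ?_⟩
    simp only [Prod.fst_inv, Prod.snd_inv, inv_c, h₁, h₃, zero_dotProduct]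
    linear_combination -h₅

instance : (antidiagonal K n).Normal where
  conj_mem := by
    rintro x ⟨⟨h₁, h₂⟩, ⟨h₃, h₄⟩, h₅⟩ g
    refine ⟨by simp [*], by simp [*], ?_⟩
    simp only [Prod.fst_mul, Prod.snd_mul, Prod.fst_inv, Prod.snd_inv, mul_a, mul_c, inv_b, inv_c,
      h₁, h₂, h₃, h₄, dotProduct_zero, add_zero, dotProduct_neg]
    linear_combination h₅

lemma normalClosure_le_antidiagonal :
    Subgroup.normalClosure
      {x : Heis K n × Heis K n | ∃ c ∈ commutator (Heis K n), x = (c, c⁻¹)} ≤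
      antidiagonal K n := by
  refine Subgroup.normalClosure_le_normal ?_
  rintro _ ⟨c, hc, rfl⟩
  obtain ⟨ha, hb⟩ := a_eq_zero_and_b_eq_zero_of_mem_commutator hc
  exact ⟨⟨ha, hb⟩, by simp [ha, hb], by simp [ha]⟩

/-- The value of a word on a tuple of the Heisenberg group is linear in the tuple up to a
bilinear form in the `a`- and `b`-parts, with coefficients depending only on the word. -/
lemma exists_lift_eq (K : Type*) [Field K] (n : ℕ) {m : ℕ} (w : FreeGroup (Fin m)) :
    ∃ (e : Fin m → K) (M : Fin m → Fin m → K), ∀ f : Fin m → Heis K n,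
      (FreeGroup.lift f w).a = ∑ i, e i • (f i).a ∧
      (FreeGroup.lift f w).b = ∑ i, e i • (f i).b ∧
      (FreeGroup.lift f w).c =
        ∑ i, e i * (f i).c + ∑ i, ∑ j, M i j * ((f i).a ⬝ᵥ (f j).b) := by
  induction w using FreeGroup.induction_on with
  | C1 => exact ⟨0, 0, fun f => by simp⟩
  | of i => exact ⟨Pi.single i 1, 0, fun f => by simp [Pi.single_apply, ite_smul]⟩
  | inv_of i _ =>
    refine ⟨-Pi.single i 1, Pi.single i (Pi.single i 1), fun f => ?_⟩
    simp [Pi.single_apply, ite_smul, ite_apply]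
  | mul x y hx hy =>
    obtain ⟨e, M, h⟩ := hx
    obtain ⟨e', M', h'⟩ := hy
    refine ⟨e + e', fun i j => M i j + M' i j + e i * e' j, fun f => ?_⟩
    obtain ⟨ha, hb, hc⟩ := h f
    obtain ⟨ha', hb', hc'⟩ := h' f
    refine ⟨?_, ?_, ?_⟩
    · simp [ha, ha', add_smul, Finset.sum_add_distrib]
    · simp [hb, hb', add_smul, Finset.sum_add_distrib]
    · have hd : (∑ i, e i • (f i).a) ⬝ᵥ (∑ j, e' j • (f j).b) =
          ∑ i, ∑ j, e i * e' j * ((f i).a ⬝ᵥ (f j).b) := by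
        simp only [sum_dotProduct, dotProduct_sum, smul_dotProduct, dotProduct_smul, smul_eq_mul,
          Finset.mul_sum]
        rw [Finset.sum_comm]
        exact Finset.sum_congr rfl fun i _ => Finset.sum_congr rfl fun j _ => by ring
      simp only [map_mul, mul_c, hc, hc', ha, hb', hd, Pi.add_apply, add_mul,
        Finset.sum_add_distrib]
      ring

/-- A word map on the Heisenberg group is surjective, or has image `{T(0, 0, c)}`, or is
trivial. -/
lemma surjective_or_range_or_trivial (hn : 1 ≤ n) {m : ℕ} (w : FreeGroup (Fin m)) :
    (∀ h : Heis K n, ∃ f : Fin m → Heis K n, FreeGroup.lift f w = h) ∨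
    ((∀ f : Fin m → Heis K n, (FreeGroup.lift f w).a = 0 ∧ (FreeGroup.lift f w).b = 0) ∧
      ((∀ c : K, ∃ f : Fin m → Heis K n, FreeGroup.lift f w = ⟨0, 0, c⟩) ∨
        ∀ f : Fin m → Heis K n, (FreeGroup.lift f w).c = 0)) := by
  obtain ⟨e, M, h⟩ := exists_lift_eq K n w
  by_cases he : e = 0
  · subst he
    refine Or.inr ⟨fun f => by simp [h f], ?_⟩
    by_cases hM : M = 0
    · exact Or.inr fun f => by simp [h f, hM]
    · obtain ⟨i, hi⟩ := Function.ne_iff.mp hM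
      obtain ⟨j, hij⟩ := Function.ne_iff.mp hi
      have hij : M i j ≠ 0 := hij
      let k : Fin n := ⟨0, hn⟩
      refine Or.inl fun c => ?_
      let f : Fin m → Heis K n := fun l =>
        ⟨if l = i then Pi.single k (c / M i j) else 0, if l = j then Pi.single k 1 else 0, 0⟩
      refine ⟨f, ?_⟩
      obtain ⟨ha, hb, hc⟩ := h f
      refine Heis.ext (by simp [ha]) (by simp [hb]) ?_
      have hsum : ∀ l l', M l l' * ((f l).a ⬝ᵥ (f l').b) =
          if l = i then if l' = j then c else 0 else 0 := by
        intro l l'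
        by_cases hl : l = i
        · by_cases hl' : l' = j
          · subst hl hl'
            simp [f, mul_div_cancel₀ _ hij]
          · simp [f, hl']
        · simp [f, hl]
      simp [hc, hsum]
  · obtain ⟨i, hi⟩ := Function.ne_iff.mp he
    have hi : e i ≠ 0 := hi
    refine Or.inl fun g => ?_
    let x : Heis K n := ⟨(e i)⁻¹ • g.a, (e i)⁻¹ • g.b,
      (e i)⁻¹ * (g.c - M i i * (((e i)⁻¹ • g.a) ⬝ᵥ ((e i)⁻¹ • g.b)))⟩
    let f : Fin m → Heis K n := fun l => if l = i then x else 1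
    refine ⟨f, ?_⟩
    have fi : f i = x := if_pos rfl
    have fne : ∀ l, l ≠ i → f l = 1 := fun l hl => if_neg hl
    obtain ⟨ha, hb, hc⟩ := h f
    refine Heis.ext ?_ ?_ ?_
    · rw [ha, Fintype.sum_eq_single i fun l hl => by simp [fne l hl], fi, smul_inv_smul₀ hi]
    · rw [hb, Fintype.sum_eq_single i fun l hl => by simp [fne l hl], fi, smul_inv_smul₀ hi]
    · rw [hc, Fintype.sum_eq_single i fun l hl => by simp [fne l hl],
        Fintype.sum_eq_single i fun l hl => by simp [fne l hl],
        Fintype.sum_eq_single i fun l hl => by simp [fne l hl], fi, mul_inv_cancel_left₀ hi]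
      exact sub_add_cancel _ _

/-- If a word takes the value `(h, 1)` on `H × H` modulo the antidiagonal, then it takes the
value `h` on `H`. -/
lemma exists_lift_eq_of_mem_antidiagonal (hn : 1 ≤ n) {m : ℕ} (w : FreeGroup (Fin m))
    (p q : Fin m → Heis K n) (h : Heis K n)
    (hw : (h, (1 : Heis K n))⁻¹ * (FreeGroup.lift p w, FreeGroup.lift q w) ∈ antidiagonal K n) :
    ∃ f : Fin m → Heis K n, FreeGroup.lift f w = h := by
  obtain hs | ⟨hab, hc⟩ := surjective_or_range_or_trivial (K := K) hn w
  · exact hs h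
  obtain ⟨⟨h₁, h₂⟩, -, h₃⟩ := hw
  obtain ⟨ha, hb⟩ := hab p
  have ha' : h.a = 0 := by simpa [ha] using h₁
  have hb' : h.b = 0 := by simpa [hb] using h₂
  have hsum : h.c = (FreeGroup.lift p w).c + (FreeGroup.lift q w).c := by
    simp only [Prod.fst_mul, Prod.snd_mul, Prod.fst_inv, Prod.snd_inv, inv_one, one_mul, mul_c,
      inv_c, inv_a, ha', neg_zero, zero_dotProduct] at h₃
    linear_combination -h₃
  obtain hc | hc := hc
  · obtain ⟨f, hf⟩ := hc h.c
    exact ⟨f, hf.trans (Heis.ext ha'.symm hb'.symm rfl)⟩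
  · exact ⟨p, Heis.ext (ha.trans ha'.symm) (hb.trans hb'.symm) (by rw [hsum, hc q, add_zero])⟩

end Heis

/-- Proposition (§4, key step): for a field `K` and `n ≥ 1`, the natural embedding
`h ↦ (h, 1)` of `H = H_n(K)` into the central product
`G = (H × H̃)/{(c, c⁻¹) : c ∈ H'}` of `H` with a copy of itself with joined commutator
subgroup is a verbally closed subgroup of `G`. -/
theorem heis_verbally_closed_in_central_product (K : Type u) [Field K] (n : ℕ)
    (hn : 1 ≤ n) :
    (((QuotientGroup.mk' (Subgroup.normalClosure
          {x : Heis K n × Heis K n | ∃ c ∈ commutator (Heis K n), x = (c, c⁻¹)})).comp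
        (MonoidHom.inl (Heis K n) (Heis K n))).range).IsVerballyClosed := by
  set N := Subgroup.normalClosure
    {x : Heis K n × Heis K n | ∃ c ∈ commutator (Heis K n), x = (c, c⁻¹)}
  set φ := (QuotientGroup.mk' N).comp (MonoidHom.inl (Heis K n) (Heis K n))
  rintro m w _ ⟨h, rfl⟩ ⟨f, hf⟩
  choose r hr using fun i => QuotientGroup.mk'_surjective N (f i)
  have lift_map {A B : Type u} [Group A] [Group B] (ψ : A →* B) (g : Fin m → A) :
      FreeGroup.lift (fun i => ψ (g i)) w = ψ (FreeGroup.lift g w) :=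
    (FreeGroup.lift_unique (ψ.comp (FreeGroup.lift g)) (by simp)).symm
  have hpair : FreeGroup.lift r w =
      (FreeGroup.lift (fun i => (r i).1) w, FreeGroup.lift (fun i => (r i).2) w) :=
    Prod.ext (lift_map (MonoidHom.fst _ _) r).symm (lift_map (MonoidHom.snd _ _) r).symm
  have hmem : (h, (1 : Heis K n))⁻¹ * FreeGroup.lift r w ∈ N := by
    rw [← QuotientGroup.eq]
    rw [← funext hr, lift_map] at hf
    exact hf.symm
  rw [hpair] at hmem
  obtain ⟨g, hg⟩ := Heis.exists_lift_eq_of_mem_antidiagonal hn w _ _ h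
    (Heis.normalClosure_le_antidiagonal hmem)
  exact ⟨fun i => φ (g i), fun i => ⟨g i, rfl⟩, by rw [lift_map, hg]⟩
end
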